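/- For every finite connected graph G, the reciprocal of the vertex expansion constant is at most 3 times the L¹-extremal observable spread: 1/φ_G ≤ 3·csobs(G). -/

import Mathlib

open Finset MeasureTheory Classical

noncomputable section

def wlen {V : Type*} {G : SimpleGraph V} (ω : V → ℝ) {u v : V} (w : G.Walk u v) : ℝ :=
  (w.darts.map (fun d => (ω d.toProd.1 + ω d.toProd.2) / 2)).sum

noncomputable def distw {V : Type*} (G : SimpleGraph V) (ω : V → ℝ) (u v : V) : ℝ :=
  sInf {x | ∃ w : G.Walk u v, wlen ω w = x}

noncomputable def vbdry {V : Type*} [Fintype V] (G : SimpleGraph V) (U : Finset V) : Finset V :=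
  U.filter (fun v => ∃ u ∉ U, G.Adj v u)

noncomputable def phi {V : Type*} [Fintype V] (G : SimpleGraph V) : ℝ :=
  sInf { r | ∃ U : Finset V, U.Nonempty ∧
    ((U \ vbdry G U).card : ℝ) ≤ (Fintype.card V : ℝ) / 2 ∧
    r = ((vbdry G U).card : ℝ) / (U.card : ℝ) }

noncomputable def sobs {X : Type*} [Fintype X] (d : X → X → ℝ) : ℝ :=
  sSup { s | ∃ f : X → ℝ, (∀ x y, |f x - f y| ≤ d x y) ∧
    s = (∑ x : X, ∑ y : X, |f x - f y|) / ((Fintype.card X : ℝ))^2 }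

noncomputable def spread {X : Type*} [Fintype X] (d : X → X → ℝ) : ℝ :=
  (∑ x : X, ∑ y : X, d x y) / ((Fintype.card X : ℝ))^2

noncomputable def csobs {V : Type*} [Fintype V] (G : SimpleGraph V) : ℝ :=
  sSup { s | ∃ ω : V → ℝ, (∀ v, 0 ≤ ω v) ∧
    (∑ v : V, ω v) / (Fintype.card V : ℝ) ≤ 1 ∧ s = sobs (distw G ω) }

theorem wlen_le_length_mul {V : Type*} {G : SimpleGraph V} {ω : V → ℝ} {c : ℝ}
    (hω : ∀ v, ω v ≤ c) {u v : V} (w : G.Walk u v) : wlen ω w ≤ w.length * c := by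
  induction w with
  | nil => simp [wlen]
  | @cons x y z h p ih =>
    have hstep : wlen ω (SimpleGraph.Walk.cons h p) = (ω x + ω y) / 2 + wlen ω p := by
      simp [wlen]
    rw [hstep, SimpleGraph.Walk.length_cons]
    push_cast
    linarith [hω x, hω y]

theorem wlen_nonneg {V : Type*} {G : SimpleGraph V} {ω : V → ℝ}
    (hω : ∀ v, 0 ≤ ω v) {u v : V} (w : G.Walk u v) : 0 ≤ wlen ω w := by
  refine List.sum_nonneg fun x hx => ?_
  obtain ⟨d, -, rfl⟩ := List.mem_map.1 hx
  linarith [hω d.toProd.1, hω d.toProd.2]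

theorem distw_le_wlen {V : Type*} {G : SimpleGraph V} {ω : V → ℝ}
    (hω : ∀ v, 0 ≤ ω v) {u v : V} (w : G.Walk u v) : distw G ω u v ≤ wlen ω w :=
  csInf_le ⟨0, by rintro _ ⟨w', rfl⟩; exact wlen_nonneg hω w'⟩ ⟨w, rfl⟩

/-- A function that is Lipschitz along edges is Lipschitz for the path metric. -/
theorem abs_sub_le_distw {V : Type*} {G : SimpleGraph V} (hG : G.Connected) {ω f : V → ℝ}
    (hf : ∀ x y, G.Adj x y → |f x - f y| ≤ (ω x + ω y) / 2) (x y : V) :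
    |f x - f y| ≤ distw G ω x y := by
  obtain ⟨w₀⟩ := hG.preconnected x y
  refine le_csInf ⟨_, w₀, rfl⟩ ?_
  rintro _ ⟨w, rfl⟩
  induction w with
  | nil => simp [wlen]
  | @cons x y z h p ih =>
    have hstep : wlen ω (SimpleGraph.Walk.cons h p) = (ω x + ω y) / 2 + wlen ω p := by
      simp [wlen]
    rw [hstep]
    linarith [abs_sub_le (f x) (f y) (f z), hf x y h, ih (hG.preconnected y z).some]

/-- The observable spreads of normalized conformal metrics are uniformly bounded. -/
theorem exists_spread_le {V : Type*} [Fintype V] {G : SimpleGraph V} (hG : G.Connected) :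
    ∃ C : ℝ, ∀ ω : V → ℝ, (∀ v, 0 ≤ ω v) → (∑ v : V, ω v) / (Fintype.card V : ℝ) ≤ 1 →
      ∀ f : V → ℝ, (∀ x y, |f x - f y| ≤ distw G ω x y) →
        (∑ x : V, ∑ y : V, |f x - f y|) / ((Fintype.card V : ℝ)) ^ 2 ≤ C := by
  have := hG.nonempty
  have hn : (0 : ℝ) < Fintype.card V := by exact_mod_cast Fintype.card_pos
  refine ⟨(∑ x : V, ∑ y : V, ((hG.preconnected x y).some.length : ℝ) * Fintype.card V) /
    ((Fintype.card V : ℝ)) ^ 2, fun ω hω hsum f hf => ?_⟩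
  rw [div_le_one hn] at hsum
  gcongr with x _ y _
  refine (hf x y).trans ((distw_le_wlen hω _).trans (wlen_le_length_mul (fun v => ?_) _))
  exact (single_le_sum (fun i _ => hω i) (mem_univ v)).trans hsum

theorem le_csobs {V : Type*} [Fintype V] {G : SimpleGraph V} (hG : G.Connected) {ω f : V → ℝ}
    (hω : ∀ v, 0 ≤ ω v) (hsum : (∑ v : V, ω v) / (Fintype.card V : ℝ) ≤ 1)
    (hf : ∀ x y, G.Adj x y → |f x - f y| ≤ (ω x + ω y) / 2) :
    (∑ x : V, ∑ y : V, |f x - f y|) / ((Fintype.card V : ℝ)) ^ 2 ≤ csobs G := by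
  obtain ⟨C, hC⟩ := exists_spread_le hG
  have hsobs : (∑ x : V, ∑ y : V, |f x - f y|) / ((Fintype.card V : ℝ)) ^ 2
      ≤ sobs (distw G ω) := by
    refine le_csSup ⟨C, ?_⟩ ⟨f, abs_sub_le_distw hG hf, rfl⟩
    rintro _ ⟨g, hg, rfl⟩
    exact hC ω hω hsum g hg
  refine hsobs.trans (le_csSup ⟨C, ?_⟩ ⟨ω, hω, hsum, rfl⟩)
  rintro _ ⟨ω', hω', hsum', rfl⟩
  refine csSup_le ⟨_, fun _ => 0, fun x y => ?_, rfl⟩ ?_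
  · simpa [distw] using Real.sInf_nonneg (by rintro _ ⟨w, rfl⟩; exact wlen_nonneg hω' w)
  · rintro _ ⟨g, hg, rfl⟩
    exact hC ω' hω' hsum' g hg

theorem csobs_nonneg {V : Type*} [Fintype V] {G : SimpleGraph V} (hG : G.Connected) :
    0 ≤ csobs G := by
  simpa using le_csobs hG (ω := 0) (f := 0) (by simp) (by simp) (by simp)

/-- Total variation of the function equal to `-1` on `P`, `1` on `R` and `0` elsewhere. -/
theorem sum_abs_indicator_sub {V : Type*} [Fintype V] {P R : Finset V} (hPR : Disjoint P R)
    {u : V → ℝ} (hu : ∀ x, u x = (if x ∈ R then 1 else 0) - (if x ∈ P then 1 else 0)) :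
    ∑ x : V, ∑ y : V, |u x - u y| =
      2 * (Fintype.card V * ((P.card : ℝ) + R.card) - (P.card : ℝ) ^ 2 - (R.card : ℝ) ^ 2) := by
  have hpt : ∀ x y, |u x - u y| =
      (if x ∈ P then (1 : ℝ) else 0) + (if x ∈ R then 1 else 0)
      + (if y ∈ P then 1 else 0) + (if y ∈ R then 1 else 0)
      - 2 * ((if x ∈ P then 1 else 0) * (if y ∈ P then 1 else 0))
      - 2 * ((if x ∈ R then 1 else 0) * (if y ∈ R then 1 else 0)) := by
    intro x y
    have hx : x ∈ P → x ∉ R := fun h => Finset.disjoint_left.1 hPR h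
    have hy : y ∈ P → y ∉ R := fun h => Finset.disjoint_left.1 hPR h
    rw [hu, hu]
    by_cases h1 : x ∈ P <;> by_cases h2 : x ∈ R <;> by_cases h3 : y ∈ P <;>
      by_cases h4 : y ∈ R <;> simp [h1, h2, h3, h4] at hx hy ⊢ <;> norm_num
  have hcard : ∀ T : Finset V, ∑ x : V, (if x ∈ T then (1 : ℝ) else 0) = T.card := by
    intro T
    simp
  simp only [hpt, sum_add_distrib, sum_sub_distrib, ← mul_sum, hcard, sum_const, card_univ,
    nsmul_eq_mul, ← sum_mul]
  ring

/-- Test-function bound: weight the vertices of `S` uniformly and use a three-valued function. -/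
theorem le_csobs_of_indicator {V : Type*} [Fintype V] {G : SimpleGraph V} (hG : G.Connected)
    {S P R : Finset V} (hS : S.Nonempty) (hPR : Disjoint P R) {u : V → ℝ}
    (hu : ∀ x, u x = (if x ∈ R then 1 else 0) - (if x ∈ P then 1 else 0))
    (hadj : ∀ x y, G.Adj x y →
      |u x - u y| ≤ (if x ∈ S then 1 else 0) + (if y ∈ S then 1 else 0)) :
    (Fintype.card V * ((P.card : ℝ) + R.card) - (P.card : ℝ) ^ 2 - (R.card : ℝ) ^ 2) /
      (Fintype.card V * S.card) ≤ csobs G := by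
  have := hG.nonempty
  have hn : (0 : ℝ) < Fintype.card V := by exact_mod_cast Fintype.card_pos
  have hs : (0 : ℝ) < S.card := by exact_mod_cast hS.card_pos
  set h : ℝ := Fintype.card V / (2 * S.card) with hh
  have hpos : 0 < h := by positivity
  have habs : ∀ x y, |h * u x - h * u y| = h * |u x - u y| := by
    intro x y
    rw [← mul_sub, abs_mul, abs_of_pos hpos]
  have key := le_csobs hG (ω := fun v => 2 * h * (if v ∈ S then 1 else 0))
    (f := fun v => h * u v) (fun v => by positivity) ?_ ?_
  · simp only [habs, ← mul_sum] at key
    rw [sum_abs_indicator_sub hPR hu] at key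
    refine le_trans (le_of_eq ?_) key
    rw [hh]
    field_simp
  · rw [← mul_sum, div_le_one hn]
    simp only [sum_ite_mem, univ_inter, sum_const, nsmul_eq_mul, mul_one]
    rw [hh]
    apply le_of_eq
    field_simp
  · intro x y hxy
    rw [habs]
    have := mul_le_mul_of_nonneg_left (hadj x y hxy) hpos.le
    linarith

theorem vbdry_nonempty {V : Type*} [Fintype V] {G : SimpleGraph V} (hG : G.Connected)
    {U : Finset V} (hU : U.Nonempty) (hne : U ≠ univ) : (vbdry G U).Nonempty := by
  obtain ⟨x, hx⟩ := hU
  obtain ⟨y, hy⟩ : ∃ y, y ∉ U := by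
    by_contra! h
    exact hne (eq_univ_iff_forall.2 h)
  obtain ⟨w⟩ := hG.preconnected x y
  obtain ⟨d, -, hd₁, hd₂⟩ := w.exists_boundary_dart (U : Set V) hx hy
  exact ⟨d.fst, mem_filter.2 ⟨hd₁, d.snd, hd₂, d.adj⟩⟩

/-- Interior `a`, boundary `s`, exterior `b`: one of the two test functions always suffices.
Here `p`, `q` are the sizes of the two halves of the boundary. -/
theorem card_inequality {a b s p q : ℕ} (hb : 1 ≤ b) (has : a ≤ b + s)
    (hpq : p + q = s) (hqp : p ≤ q) (hqp' : q ≤ p + 1) :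
    ((a : ℝ) + b + s) * (a + s) ≤
        3 * ((a + b + s) * ((a : ℝ) + b) - (a : ℝ) ^ 2 - (b : ℝ) ^ 2) ∨
      ((a : ℝ) + b + s) * (a + s) ≤
        3 * ((a + b + s) * ((p : ℝ) + q) - (p : ℝ) ^ 2 - (q : ℝ) ^ 2) := by
  have hb' : (1 : ℝ) ≤ b := by exact_mod_cast hb
  have has' : (a : ℝ) ≤ b + s := by exact_mod_cast has
  have ha0 : (0 : ℝ) ≤ a := by positivity
  have hs0 : (0 : ℝ) ≤ s := by positivity
  have hmul : 0 ≤ (a : ℝ) * (b + s - a) := mul_nonneg ha0 (by linarith)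
  have hpqr : (p : ℝ) + q = s := by exact_mod_cast hpq
  have hsq : 2 * ((p : ℝ) ^ 2 + (q : ℝ) ^ 2) ≤ (s : ℝ) ^ 2 + 1 := by
    have h1 : (p : ℝ) ≤ q := by exact_mod_cast hqp
    have h2 : (q : ℝ) ≤ p + 1 := by exact_mod_cast hqp'
    rw [← hpqr]
    nlinarith
  by_cases hcase : (s : ℝ) ^ 2 ≤ 4 * a * b + 2 * s * b
  · left
    nlinarith
  · right
    push Not at hcase
    have hab : 0 ≤ (a : ℝ) * b := by positivity
    have h2b : 2 * (b : ℝ) < s := by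
      by_contra! h
      nlinarith
    have hs3 : (3 : ℝ) ≤ s := by
      have : 2 * b < s := by exact_mod_cast h2b
      have : 3 ≤ s := by omega
      exact_mod_cast this
    have hbs : (3 : ℝ) ≤ b * s := by nlinarith
    rw [hpqr]
    rcases le_total (a : ℝ) s with h | h
    · have : 0 ≤ (b : ℝ) * (s - a) := mul_nonneg (by linarith) (by linarith)
      nlinarith
    · nlinarith

theorem card_div_card_vbdry_le {V : Type*} [Fintype V] {G : SimpleGraph V} (hG : G.Connected)
    {U : Finset V} (hU : U.Nonempty)
    (hcard : ((U \ vbdry G U).card : ℝ) ≤ (Fintype.card V : ℝ) / 2) :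
    (U.card : ℝ) / (vbdry G U).card ≤ 3 * csobs G := by
  have hV := hG.nonempty
  have hne : U ≠ univ := by
    rintro rfl
    have hn : (0 : ℝ) < Fintype.card V := by exact_mod_cast Fintype.card_pos
    have : vbdry G univ = ∅ := by simp [vbdry]
    rw [this, sdiff_empty, card_univ] at hcard
    linarith
  have hS := vbdry_nonempty hG hU hne
  have hmemS : ∀ x, x ∈ vbdry G U ↔ x ∈ U ∧ ∃ y ∉ U, G.Adj x y := fun x => by simp [vbdry]
  have hsub : vbdry G U ⊆ U := filter_subset _ _
  set S := vbdry G U with hSdef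
  obtain ⟨P, hPS, hPcard⟩ := exists_subset_card_eq (Nat.div_le_self S.card 2)
  have hPQ := card_sdiff_add_card_eq_card hPS
  have hAS := card_sdiff_add_card_eq_card hsub
  have hUB : Uᶜ.card + U.card = Fintype.card V := by
    rw [add_comm]; exact card_add_card_compl U
  have hb : 1 ≤ Uᶜ.card := card_pos.2 (by
    rw [nonempty_iff_ne_empty]
    simpa using hne)
  have hcard' : 2 * (U \ S).card ≤ Fintype.card V := by
    have : (2 : ℝ) * (U \ S).card ≤ Fintype.card V := by linarith
    exact_mod_cast this
  have hn : (Fintype.card V : ℝ) = (U \ S).card + Uᶜ.card + S.card := by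
    have : Fintype.card V = (U \ S).card + Uᶜ.card + S.card := by omega
    exact_mod_cast this
  have hUr : (U.card : ℝ) = (U \ S).card + S.card := by exact_mod_cast hAS.symm
  have hs : (0 : ℝ) < S.card := by exact_mod_cast hS.card_pos
  have hnpos : (0 : ℝ) < Fintype.card V := by exact_mod_cast Fintype.card_pos
  have finish : ∀ K : ℝ, K / (Fintype.card V * S.card) ≤ csobs G →
      (Fintype.card V : ℝ) * U.card ≤ 3 * K → (U.card : ℝ) / S.card ≤ 3 * csobs G := by
    intro K hK h
    refine le_trans ?_ (mul_le_mul_of_nonneg_left hK (by norm_num))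
    rw [← mul_div_assoc, div_le_div_iff₀ hs (by positivity)]
    nlinarith
  rcases card_inequality (a := (U \ S).card) (b := Uᶜ.card) (s := S.card) (p := P.card)
    (q := (S \ P).card) hb (by omega) (by omega) (by omega) (by omega) with h | h
  · refine finish _ (le_csobs_of_indicator hG hS (P := U \ S) (R := Uᶜ) ?_ (fun _ => rfl) ?_) ?_
    · exact disjoint_left.2 fun x hx => by simp_all
    · intro x y hxy
      have hx := hmemS x
      have hy := hmemS y
      have hx' : x ∈ U → y ∉ U → x ∈ S := fun h1 h2 => hx.2 ⟨h1, y, h2, hxy⟩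
      have hy' : y ∈ U → x ∉ U → y ∈ S := fun h1 h2 => hy.2 ⟨h1, x, h2, hxy.symm⟩
      have hxU := @hsub x
      have hyU := @hsub y
      clear hx hy
      by_cases h1 : x ∈ U <;> by_cases h2 : x ∈ S <;> by_cases h3 : y ∈ U <;>
        by_cases h4 : y ∈ S <;> simp [h1, h2, h3, h4] at hx' hy' hxU hyU ⊢
    · rw [hn, hUr]; exact h
  · refine finish _ (le_csobs_of_indicator hG hS (P := P) (R := S \ P) ?_ (fun _ => rfl) ?_) ?_
    · exact disjoint_sdiff
    · intro x y _
      have hxS := @hPS x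
      have hyS := @hPS y
      by_cases h1 : x ∈ P <;> by_cases h2 : x ∈ S <;> by_cases h3 : y ∈ P <;>
        by_cases h4 : y ∈ S <;> simp [h1, h2, h3, h4] at hxS hyS ⊢ <;> norm_num
    · rw [hn, hUr]; exact h

theorem stmt1 {V : Type*} [Fintype V] (G : SimpleGraph V) (hG : G.Connected) :
    1 / phi G ≤ 3 * csobs G := by
  set A := { r : ℝ | ∃ U : Finset V, U.Nonempty ∧
    ((U \ vbdry G U).card : ℝ) ≤ (Fintype.card V : ℝ) / 2 ∧
    r = ((vbdry G U).card : ℝ) / (U.card : ℝ) } with hA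
  have hphi : phi G = sInf A := rfl
  rcases A.eq_empty_or_nonempty with hE | hE
  · rw [hphi, hE, Real.sInf_empty, div_zero]
    linarith [csobs_nonneg hG]
  · have hfin : A.Finite := by
      refine (Set.finite_range fun U : Finset V =>
        ((vbdry G U).card : ℝ) / (U.card : ℝ)).subset ?_
      rintro _ ⟨U, -, -, rfl⟩
      exact ⟨U, rfl⟩
    obtain ⟨U, hU, hcard, hr⟩ := hE.csInf_mem hfin
    rw [hphi, hr, one_div_div]
    exact card_div_card_vbdry_le hG hU hcard

end
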